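/- Let S/R be a G-Galois extension of commutative rings and let T be any commutative R-algebra. Then T ⊗_R S, with G acting by T-algebra automorphisms through the second tensor factor, is a G-Galois extension of T: the fixed subring (T ⊗_R S)^G equals the image of T, and the map Θ : (T ⊗_R S) ⊗_T (T ⊗_R S) → ∏_{γ∈G} (T ⊗_R S) is bijective. -/

import Mathlib

open scoped TensorProduct

/-- The map `Θ : S ⊗[R] S → ∏_{γ ∈ G} S`, `Θ(u ⊗ v) = (u · (γ • v))_{γ ∈ G}`,
where `G` acts on `S` via a homomorphism `ρ : G →* (S ≃ₐ[R] S)`. -/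
noncomputable def thetaMap (R S G : Type) [CommRing R] [CommRing S] [Algebra R S]
    [Group G] (ρ : G →* (S ≃ₐ[R] S)) : S ⊗[R] S →ₗ[R] (G → S) :=
  TensorProduct.lift
    (LinearMap.mk₂ R (fun u v γ => u * ρ γ v)
      (fun u u' v => by funext γ; simp [add_mul])
      (fun c u v => by funext γ; simp [smul_mul_assoc])
      (fun u v v' => by funext γ; simp [mul_add])
      (fun c u v => by funext γ; simp [mul_smul_comm]))

/-- `S/R` is a `G`-Galois extension: the fixed subring `S^G` equals the image of `R`
and `Θ` is bijective. -/
def IsBNGaloisExtension (R S G : Type) [CommRing R] [CommRing S] [Algebra R S]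
    [Group G] (ρ : G →* (S ≃ₐ[R] S)) : Prop :=
  ({s : S | ∀ γ : G, ρ γ s = s} = Set.range (algebraMap R S)) ∧
  Function.Bijective (thetaMap R S G ρ)

/-- A finite family `(x i, y i)` with `∑ i, x i * γ (y i) = δ_{γ, 1}` for all `γ : G`. -/
def IsGaloisCoordinates {R S G ι : Type} [CommRing R] [CommRing S] [Algebra R S]
    [Group G] (ρ : G →* (S ≃ₐ[R] S)) (s : Finset ι) (x y : ι → S) : Prop :=
  (∑ i ∈ s, x i * y i = 1) ∧ ∀ γ : G, γ ≠ 1 → ∑ i ∈ s, x i * ρ γ (y i) = 0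

theorem thetaMap_tmul {R S G : Type} [CommRing R] [CommRing S] [Algebra R S]
    [Group G] (ρ : G →* (S ≃ₐ[R] S)) (u v : S) (γ : G) :
    thetaMap R S G ρ (u ⊗ₜ[R] v) γ = u * ρ γ v := by
  simp [thetaMap]

theorem trace_fixed {R S G : Type} [CommRing R] [CommRing S] [Algebra R S]
    [Group G] [Fintype G] (ρ : G →* (S ≃ₐ[R] S)) (a : S) (σ : G) :
    ρ σ (∑ γ : G, ρ γ a) = ∑ γ : G, ρ γ a := by
  rw [map_sum]
  exact Fintype.sum_equiv (Equiv.mulLeft σ) _ _ fun γ => by simp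

theorem exists_isGaloisCoordinates {R S G : Type} [CommRing R] [CommRing S] [Algebra R S]
    [Group G] (ρ : G →* (S ≃ₐ[R] S)) (h : Function.Surjective (thetaMap R S G ρ)) :
    ∃ s : Finset (S × S), IsGaloisCoordinates ρ s Prod.fst Prod.snd := by
  classical
  obtain ⟨z, hz⟩ := h (Pi.single 1 1)
  obtain ⟨s, rfl⟩ := TensorProduct.exists_finset z
  have key (γ : G) : ∑ i ∈ s, i.1 * ρ γ i.2 = (Pi.single 1 1 : G → S) γ := by
    rw [← hz, map_sum, Finset.sum_apply]
    simp only [thetaMap_tmul]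
  exact ⟨s, by simpa using key 1, fun γ hγ => by simpa [hγ] using key γ⟩

namespace IsGaloisCoordinates

variable {R S G ι : Type} [CommRing R] [CommRing S] [Algebra R S] [Group G]
  {ρ : G →* (S ≃ₐ[R] S)} {s : Finset ι} {x y : ι → S}

theorem sum_apply_mul_apply [DecidableEq G] (h : IsGaloisCoordinates ρ s x y) (γ σ : G) :
    ∑ i ∈ s, ρ γ (x i) * ρ σ (y i) = if γ = σ then 1 else 0 := by
  have key : ∑ i ∈ s, ρ γ (x i) * ρ σ (y i) = ρ γ (∑ i ∈ s, x i * ρ (γ⁻¹ * σ) (y i)) := by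
    simp [← AlgEquiv.mul_apply, ← map_mul ρ, -map_mul, map_sum, map_mul (ρ γ)]
  rw [key]
  split_ifs with hγ
  · simp [hγ, h.1]
  · rw [h.2 _ (by rwa [Ne, inv_mul_eq_one]), map_zero]

theorem sum_trace_mul [Fintype G] (h : IsGaloisCoordinates ρ s x y) (v : S) :
    ∑ i ∈ s, (∑ γ : G, ρ γ (v * x i)) * y i = v := by
  classical
  have key (γ : G) : ∑ i ∈ s, ρ γ (v * x i) * y i = if γ = 1 then v else 0 := by
    have := h.sum_apply_mul_apply γ 1
    simp only [map_one, AlgEquiv.one_apply] at this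
    simp_rw [map_mul, mul_assoc, ← Finset.mul_sum, this]
    split_ifs with hγ <;> simp [hγ]
  simp_rw [Finset.sum_mul]
  rw [Finset.sum_comm]
  simp_rw [key]
  simp

theorem bijective_thetaMap [Fintype G] (h : IsGaloisCoordinates ρ s x y)
    (hfix : ∀ a : S, (∀ γ : G, ρ γ a = a) → a ∈ Set.range (algebraMap R S)) :
    Function.Bijective (thetaMap R S G ρ) := by
  classical
  let ψ : (G → S) →+ S ⊗[R] S :=
    { toFun := fun f => ∑ i ∈ s, (∑ γ : G, f γ * ρ γ (x i)) ⊗ₜ[R] y i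
      map_zero' := by simp
      map_add' := fun f g => by
        simp [add_mul, Finset.sum_add_distrib, TensorProduct.add_tmul] }
  have hψ (f : G → S) : ψ f = ∑ i ∈ s, (∑ γ : G, f γ * ρ γ (x i)) ⊗ₜ[R] y i := rfl
  refine Function.bijective_iff_has_inverse.2 ⟨ψ, fun z => ?_, fun f => ?_⟩
  · induction z with
    | zero => simp
    | add a b ha hb => rw [map_add, map_add, ha, hb]
    | tmul u v =>
      have key (i : ι) : (∑ γ : G, u * ρ γ v * ρ γ (x i)) ⊗ₜ[R] y i =
          u ⊗ₜ[R] ((∑ γ : G, ρ γ (v * x i)) * y i) := by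
        obtain ⟨r, hr⟩ := hfix _ (trace_fixed ρ (v * x i))
        simp_rw [mul_assoc, ← Finset.mul_sum, ← map_mul]
        rw [← hr, mul_comm, ← Algebra.smul_def, ← Algebra.smul_def, TensorProduct.smul_tmul]
      simp_rw [hψ, thetaMap_tmul, key, ← TensorProduct.tmul_sum, h.sum_trace_mul]
  · funext σ
    rw [hψ, map_sum, Finset.sum_apply]
    simp_rw [thetaMap_tmul, Finset.sum_mul]
    rw [Finset.sum_comm]
    simp_rw [mul_assoc, ← Finset.mul_sum, h.sum_apply_mul_apply]
    simp

theorem exists_trace_eq_one [Fintype G] (h : IsGaloisCoordinates ρ s x y)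
    (hfix : ∀ a : S, (∀ γ : G, ρ γ a = a) → a ∈ Set.range (algebraMap R S)) :
    ∃ c : S, ∑ γ : G, ρ γ c = 1 := by
  let tr : S →ₗ[R] S := ∑ γ : G, (ρ γ).toLinearMap
  have htr (a : S) : tr a = ∑ γ : G, ρ γ a := by simp [tr]
  let I : Ideal R := (LinearMap.range tr).comap (Algebra.linearMap R S)
  have hmem (v : S) (N : Submodule R S) (hN : ∀ i ∈ s, y i ∈ N) : v ∈ I • N := by
    rw [← h.sum_trace_mul v]
    refine Submodule.sum_mem _ fun i hi => ?_
    obtain ⟨r, hr⟩ := hfix _ (trace_fixed ρ (v * x i))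
    rw [← hr, ← Algebra.smul_def]
    refine Submodule.smul_mem_smul ?_ (hN i hi)
    exact ⟨v * x i, by rw [htr, ← hr, Algebra.linearMap_apply]⟩
  have hfg : (⊤ : Submodule R S).FG := by
    classical
    refine ⟨s.image y, eq_top_iff.2 fun v _ => Submodule.smul_le_right (hmem v _ fun i hi => ?_)⟩
    exact Submodule.subset_span (by simpa using ⟨i, hi, rfl⟩)
  obtain ⟨r, hr, hr0⟩ := Submodule.exists_sub_one_mem_and_smul_eq_zero_of_fg_of_le_smul I ⊤ hfg
    fun v _ => hmem v ⊤ fun _ _ => Submodule.mem_top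
  obtain ⟨c, hc⟩ := hr
  have hr1 : algebraMap R S r = 0 := by
    rw [Algebra.algebraMap_eq_smul_one, hr0 1 Submodule.mem_top]
  refine ⟨-c, ?_⟩
  rw [← htr, map_neg, hc]
  simp [hr1]

end IsGaloisCoordinates

/-- The action of `G` on `T ⊗[R] S` through the second factor. -/
noncomputable def baseChangeAction (R S G T : Type) [CommRing R] [CommRing S] [Algebra R S]
    [CommRing T] [Algebra R T] [Group G] (ρ : G →* (S ≃ₐ[R] S)) :
    G →* ((T ⊗[R] S) ≃ₐ[T] (T ⊗[R] S)) where
  toFun γ := Algebra.TensorProduct.congr AlgEquiv.refl (ρ γ)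
  map_one' := by
    ext z
    induction z with
    | zero => simp
    | add a b ha hb => rw [map_add, map_add, ha, hb]
    | tmul t a => simp
  map_mul' γ σ := by
    ext z
    induction z with
    | zero => simp
    | add a b ha hb => rw [map_add, map_add, ha, hb]
    | tmul t a => simp

theorem baseChangeAction_tmul {R S G T : Type} [CommRing R] [CommRing S] [Algebra R S]
    [CommRing T] [Algebra R T] [Group G] (ρ : G →* (S ≃ₐ[R] S)) (γ : G) (t : T) (a : S) :
    baseChangeAction R S G T ρ γ (t ⊗ₜ[R] a) = t ⊗ₜ[R] ρ γ a := by
  simp [baseChangeAction]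

theorem IsGaloisCoordinates.baseChange {R S G ι : Type} (T : Type) [CommRing R] [CommRing S]
    [Algebra R S] [CommRing T] [Algebra R T] [Group G] {ρ : G →* (S ≃ₐ[R] S)} {s : Finset ι}
    {x y : ι → S} (h : IsGaloisCoordinates ρ s x y) :
    IsGaloisCoordinates (baseChangeAction R S G T ρ) s
      (fun i => (1 : T) ⊗ₜ[R] x i) (fun i => (1 : T) ⊗ₜ[R] y i) := by
  refine ⟨?_, fun γ hγ => ?_⟩
  · simp_rw [Algebra.TensorProduct.tmul_mul_tmul, ← TensorProduct.tmul_sum, h.1, mul_one,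
      Algebra.TensorProduct.one_def]
  · simp_rw [baseChangeAction_tmul, Algebra.TensorProduct.tmul_mul_tmul,
      ← TensorProduct.tmul_sum, h.2 γ hγ, TensorProduct.tmul_zero]

theorem trace_baseChangeAction_mem_range {R S G T : Type} [CommRing R] [CommRing S] [Algebra R S]
    [CommRing T] [Algebra R T] [Group G] [Fintype G] (ρ : G →* (S ≃ₐ[R] S))
    (hfix : ∀ a : S, (∀ γ : G, ρ γ a = a) → a ∈ Set.range (algebraMap R S)) (z : T ⊗[R] S) :
    ∑ γ : G, baseChangeAction R S G T ρ γ z ∈ (algebraMap T (T ⊗[R] S)).range := by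
  induction z with
  | zero => simp
  | add a b ha hb =>
    simp_rw [map_add, Finset.sum_add_distrib]
    exact add_mem ha hb
  | tmul t a =>
    obtain ⟨r, hr⟩ := hfix _ (trace_fixed ρ a)
    simp_rw [baseChangeAction_tmul, ← TensorProduct.tmul_sum, ← hr]
    refine ⟨r • t, ?_⟩
    rw [Algebra.TensorProduct.algebraMap_apply, Algebra.algebraMap_eq_smul_one (A := S),
      TensorProduct.tmul_smul, TensorProduct.smul_tmul', Algebra.algebraMap_self, RingHom.id_apply]

/-- Base change: if `S/R` is `G`-Galois and `T` is any commutative `R`-algebra, then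
`T ⊗[R] S`, with `G` acting through the second tensor factor by `T`-algebra
automorphisms, is a `G`-Galois extension of `T`. -/
theorem stmt7 (R S G T : Type) [CommRing R] [CommRing S] [Algebra R S]
    [CommRing T] [Algebra R T]
    [Group G] [Fintype G] (ρ : G →* (S ≃ₐ[R] S))
    (hgal : IsBNGaloisExtension R S G ρ) :
    ∃ ρ' : G →* ((T ⊗[R] S) ≃ₐ[T] (T ⊗[R] S)),
      (∀ (γ : G) (t : T) (s : S), ρ' γ (t ⊗ₜ[R] s) = t ⊗ₜ[R] (ρ γ s)) ∧
      IsBNGaloisExtension T (T ⊗[R] S) G ρ' := by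
  have hfix (a : S) (ha : ∀ γ : G, ρ γ a = a) : a ∈ Set.range (algebraMap R S) :=
    hgal.1.subset ha
  obtain ⟨s, hs⟩ := exists_isGaloisCoordinates ρ hgal.2.surjective
  obtain ⟨c, hc⟩ := hs.exists_trace_eq_one hfix
  have hfix' (z : T ⊗[R] S) (hz : ∀ γ : G, baseChangeAction R S G T ρ γ z = z) :
      z ∈ Set.range (algebraMap T (T ⊗[R] S)) := by
    have key : ∑ γ : G, baseChangeAction R S G T ρ γ (z * (1 : T) ⊗ₜ[R] c) = z := by
      simp_rw [map_mul, hz, ← Finset.mul_sum, baseChangeAction_tmul, ← TensorProduct.tmul_sum,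
        hc, ← Algebra.TensorProduct.one_def, mul_one]
    rw [← key]
    exact trace_baseChangeAction_mem_range ρ hfix _
  refine ⟨baseChangeAction R S G T ρ, baseChangeAction_tmul ρ, ?_,
    (hs.baseChange T).bijective_thetaMap hfix'⟩
  refine Set.Subset.antisymm hfix' ?_
  rintro _ ⟨t, rfl⟩ γ
  exact AlgEquiv.commutes _ t
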